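/- A presheaf X : 𝔽 ⥤ Type is super-finitary if and only if there exist finitely many finite sets Γ₁, …, Γ_k and an epimorphism from the coproduct of the representable presheaves 𝔽(Γ₁, −), …, 𝔽(Γ_k, −) onto X (equivalently, X is a quotient of the polynomial presheaf Γ ↦ Γ^{n₁} + ⋯ + Γ^{n_k} of a finite signature, where n_i = card Γ_i). -/

import Mathlib

open CategoryTheory CategoryTheory.Limits

/-- A presheaf `X : 𝔽 ⥤ Type` is super-finitary if every `X(Γ)` is finite and there is a
nonempty context `Γ₀` generating `X`: every element of `X(Γ)` for nonempty `Γ` is of the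
form `X(γ)(b)` for some `γ : Γ₀ → Γ` and `b ∈ X(Γ₀)`. -/
def SuperFinitary (X : FintypeCat.{0} ⥤ Type) : Prop :=
  (∀ Γ : FintypeCat, Finite (X.obj Γ)) ∧
    ∃ Γ₀ : FintypeCat, Nonempty Γ₀ ∧
      ∀ Γ : FintypeCat, Nonempty Γ →
        ∀ a : X.obj Γ, ∃ (γ : Γ₀ ⟶ Γ) (b : X.obj Γ₀), X.map γ b = a

/-- A morphism out of a coproduct of representables is an epimorphism iff the elements classified
by its components generate the target. -/
theorem epi_sigma_coyoneda_iff {C : Type*} [Category.{0} C] {k : ℕ} (Γ : Fin k → C)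
    (X : C ⥤ Type) (q : (∐ fun i => coyoneda.obj (Opposite.op (Γ i))) ⟶ X) :
    Epi q ↔ ∀ (Δ : C) (x : X.obj Δ), ∃ (i : Fin k) (γ : Γ i ⟶ Δ),
      X.map γ (coyonedaEquiv (Sigma.ι (fun i => coyoneda.obj (Opposite.op (Γ i))) i ≫ q)) = x := by
  have key (i : Fin k) (Δ : C) (γ : Γ i ⟶ Δ) :
      X.map γ (coyonedaEquiv (Sigma.ι (fun i => coyoneda.obj (Opposite.op (Γ i))) i ≫ q)) =
        q.app Δ ((Sigma.ι (fun i => coyoneda.obj (Opposite.op (Γ i))) i).app Δ γ) := by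
    rw [map_coyonedaEquiv]
    rfl
  simp only [NatTrans.epi_iff_epi_app, epi_iff_surjective, key]
  refine forall_congr' fun Δ => ⟨fun h x => ?_, fun h x => ?_⟩
  · obtain ⟨y, rfl⟩ := h x
    obtain ⟨⟨i⟩, γ, rfl⟩ := Types.jointly_surjective_of_isColimit
      (isColimitOfPreserves ((evaluation C Type).obj Δ)
        (coproductIsCoproduct fun i => coyoneda.obj (Opposite.op (Γ i)))) y
    exact ⟨i, γ, rfl⟩
  · obtain ⟨i, γ, h⟩ := h x
    exact ⟨_, h⟩

/-- A functor is a quotient of a finite coproduct of representables iff it is generated by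
finitely many elements. -/
theorem exists_epi_sigma_coyoneda_iff {C : Type*} [Category.{0} C] (X : C ⥤ Type) :
    (∃ (k : ℕ) (Γ : Fin k → C) (q : (∐ fun i => coyoneda.obj (Opposite.op (Γ i))) ⟶ X), Epi q) ↔
      ∃ (k : ℕ) (Γ : Fin k → C) (a : ∀ i, X.obj (Γ i)),
        ∀ (Δ : C) (x : X.obj Δ), ∃ (i : Fin k) (γ : Γ i ⟶ Δ), X.map γ (a i) = x := by
  refine exists_congr fun k => exists_congr fun Γ => ⟨fun ⟨q, hq⟩ => ?_, fun ⟨a, ha⟩ => ?_⟩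
  · exact ⟨_, (epi_sigma_coyoneda_iff Γ X q).1 hq⟩
  · refine ⟨Sigma.desc fun i => coyonedaEquiv.symm (a i), (epi_sigma_coyoneda_iff Γ X _).2 ?_⟩
    simpa using ha

/-- A super-finitary presheaf is generated by its elements over the generating context together
with its elements over the empty context. -/
theorem SuperFinitary.exists_generators {X : FintypeCat.{0} ⥤ Type} (hX : SuperFinitary X) :
    ∃ (k : ℕ) (Γ : Fin k → FintypeCat.{0}) (a : ∀ i, X.obj (Γ i)),
      ∀ (Δ : FintypeCat.{0}) (x : X.obj Δ), ∃ (i : Fin k) (γ : Γ i ⟶ Δ), X.map γ (a i) = x := by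
  obtain ⟨hfin, Γ₀, -, hgen⟩ := hX
  let E : FintypeCat.{0} := .of Empty
  have := hfin Γ₀
  have := hfin E
  obtain ⟨k, ⟨e⟩⟩ := Finite.exists_equiv_fin (X.obj Γ₀ ⊕ X.obj E)
  let a : ∀ s : X.obj Γ₀ ⊕ X.obj E, X.obj (Sum.elim (fun _ => Γ₀) (fun _ => E) s)
    | .inl b => b
    | .inr b => b
  refine ⟨k, fun i => Sum.elim (fun _ => Γ₀) (fun _ => E) (e.symm i), fun i => a (e.symm i),
    fun Δ x => ?_⟩
  suffices h : ∃ s, ∃ γ : Sum.elim (fun _ => Γ₀) (fun _ => E) s ⟶ Δ, X.map γ (a s) = x by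
    obtain ⟨s, h⟩ := h
    obtain ⟨i, rfl⟩ := e.symm.surjective s
    exact ⟨i, h⟩
  rcases isEmpty_or_nonempty Δ with hΔ | hΔ
  · let f : E ≅ Δ := FintypeCat.equivEquivIso (Equiv.equivOfIsEmpty Empty Δ)
    exact ⟨.inr (X.map f.inv x), f.hom, ConcreteCategory.congr_hom (X.mapIso f).inv_hom_id x⟩
  · obtain ⟨γ, b, h⟩ := hgen Δ hΔ x
    exact ⟨.inl b, γ, h⟩

/-- A presheaf generated by finitely many elements is super-finitary. -/
theorem SuperFinitary.of_generators {X : FintypeCat.{0} ⥤ Type} {ι : Type} [Finite ι]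
    (Γ : ι → FintypeCat.{0}) (a : ∀ i, X.obj (Γ i))
    (ha : ∀ (Δ : FintypeCat.{0}) (x : X.obj Δ), ∃ (i : ι) (γ : Γ i ⟶ Δ), X.map γ (a i) = x) :
    SuperFinitary X := by
  refine ⟨fun Δ => ?_, .of (Option (Σ i, Γ i)), ⟨none⟩, fun Δ ⟨d⟩ x => ?_⟩
  · refine Finite.of_surjective (fun p : Σ i, Γ i ⟶ Δ => X.map p.2 (a p.1)) fun x => ?_
    obtain ⟨i, γ, h⟩ := ha Δ x
    exact ⟨⟨i, γ⟩, h⟩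
  · obtain ⟨i, γ, rfl⟩ := ha Δ x
    classical
    let incl : Γ i ⟶ .of (Option (Σ i, Γ i)) := FintypeCat.homMk fun g => some ⟨i, g⟩
    let ext : FintypeCat.of (Option (Σ i, Γ i)) ⟶ Δ := FintypeCat.homMk fun
      | none => d
      | some ⟨j, g⟩ => if h : j = i then γ (h ▸ g) else d
    have hγ : incl ≫ ext = γ := by
      ext g
      exact dif_pos rfl
    exact ⟨ext, X.map incl (a i), by rw [← hγ, Functor.map_comp_apply]⟩

/-- A presheaf `X : 𝔽 ⥤ Type` is super-finitary iff there are finitely many finite sets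
`Γ₁, …, Γ_k` and an epimorphism from the coproduct of the representable presheaves
`𝔽(Γᵢ, −)` onto `X`, i.e. `X` is a quotient of the polynomial presheaf of a finite
signature. -/
theorem superFinitary_iff_quotient_of_finite_coproduct_of_representables
    (X : FintypeCat.{0} ⥤ Type) :
    SuperFinitary X ↔
      ∃ (k : ℕ) (Γ : Fin k → FintypeCat.{0})
        (q : (∐ fun i => coyoneda.obj (Opposite.op (Γ i))) ⟶ X), Epi q := by
  rw [exists_epi_sigma_coyoneda_iff]
  exact ⟨fun h => h.exists_generators, fun ⟨_, Γ, a, ha⟩ => .of_generators Γ a ha⟩
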